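/- There exists an absolute constant C > 0 such that for every 1 ≤ p ≤ ∞, every real sequence β̄ = (β_k), every sequence ψ(k) > 0 with Σ_{k=1}^∞ ψ(k) < ∞, and every n ∈ ℕ, one has | Ẽ_n(C^ψ_{β̄,1})_{L_p} − (2^{1−1/p}/π^{1+1/p}) ‖cos t‖_p^2 ψ(n) | ≤ C ( ψ(n)/n + Σ_{ν=n+1}^∞ ψ(ν) ). -/

import Mathlib

open MeasureTheory Real Set
open scoped ENNReal

/-- The `L_p` "norm" of a (2π-periodic) function over one period `(0, 2π]`. -/
noncomputable def LpNormPer (p : ℝ≥0∞) (f : ℝ → ℝ) : ℝ :=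
  (eLpNorm f p (volume.restrict (Ioc (0:ℝ) (2*π)))).toReal

/-- `‖cos t‖_p` over one period. -/
noncomputable def cosLp (p : ℝ≥0∞) : ℝ := LpNormPer p Real.cos

/-- `T` is a trigonometric polynomial of order (degree) at most `m`. -/
def IsTrigPolyDeg (m : ℕ) (T : ℝ → ℝ) : Prop :=
  ∃ a b : ℕ → ℝ, ∀ x : ℝ, T x = a 0 / 2 +
    ∑ k ∈ Finset.Icc 1 m, (a k * Real.cos (k * x) + b k * Real.sin (k * x))

/-- Admissible `φ`: 2π-periodic, integrable on a period, `φ ⊥ 1`, `‖φ‖₁ ≤ 1`. -/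
def AdmPhi (φ : ℝ → ℝ) : Prop :=
  (∀ t : ℝ, φ (t + 2*π) = φ t) ∧ IntegrableOn φ (Ioc (0:ℝ) (2*π)) volume ∧
  (∫ t in (0:ℝ)..(2*π), φ t) = 0 ∧ (∫ t in (0:ℝ)..(2*π), |φ t|) ≤ 1

/-- The generating kernel `Ψ_β̄(t) = Σ_{k≥1} ψ(k) cos(kt − πβ_k/2)`. -/
noncomputable def ker1 (ψ βb : ℕ → ℝ) (t : ℝ) : ℝ :=
  ∑' k : ℕ, ψ (k+1) * Real.cos ((k+1 : ℝ) * t - π * βb (k+1) / 2)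

/-- The class `C^ψ_{β̄,1}` of convolutions `f = a₀/2 + (1/π) Ψ_β̄ * φ`. -/
def ClassC (ψ βb : ℕ → ℝ) : Set (ℝ → ℝ) :=
  { f | ∃ a₀ : ℝ, ∃ φ : ℝ → ℝ, AdmPhi φ ∧
      ∀ x : ℝ, f x = a₀ / 2 + (1/π) * ∫ t in (0:ℝ)..(2*π), ker1 ψ βb (x - t) * φ t }

/-- `T` is the interpolation trigonometric polynomial `S̃_{n-1}(f)` of `f` at the
equidistant nodes `x_k^{(n-1)} = 2kπ/(2n-1)`. -/
def InterpolatesAt (n : ℕ) (T f : ℝ → ℝ) : Prop :=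
  IsTrigPolyDeg (n - 1) T ∧
  ∀ k : ℤ, T (2 * (k:ℝ) * π / (2 * (n:ℝ) - 1)) = f (2 * (k:ℝ) * π / (2 * (n:ℝ) - 1))

/-- `Ẽ_n(F)_{L_p} = sup_{f ∈ F} ‖f − S̃_{n-1}(f;·)‖_p`. -/
noncomputable def interpErr (p : ℝ≥0∞) (n : ℕ) (F : Set (ℝ → ℝ)) : ℝ :=
  sSup { e : ℝ | ∃ f ∈ F, ∃ T : ℝ → ℝ, InterpolatesAt n T f ∧
    e = LpNormPer p (fun x => f x - T x) }

/-- Lagrange interpolation operator. -/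
noncomputable def Lag (n : ℕ) (g : ℝ → ℝ) (x : ℝ) : ℝ :=
  (1 / (2 * (n:ℝ) - 1)) * ∑ j ∈ Finset.range (2 * n - 1),
    g (2 * (j:ℝ) * π / (2 * (n:ℝ) - 1)) *
      (1 + 2 * ∑ m ∈ Finset.Icc 1 (n - 1), cos (m * (x - 2 * (j:ℝ) * π / (2 * (n:ℝ) - 1))))

lemma castN (n : ℕ) (hn : 1 ≤ n) : ((2 * n - 1 : ℕ) : ℝ) = 2 * (n:ℝ) - 1 := by
  rw [Nat.cast_sub (by omega)]; push_cast; ring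

lemma sum_cos_nodes (n : ℕ) (hn : 1 ≤ n) (q : ℤ) (α : ℝ) (hq : ¬ ((2 * n - 1 : ℕ) : ℤ) ∣ q) :
    ∑ j ∈ Finset.range (2 * n - 1), cos (q * (2 * (j:ℝ) * π / (2 * (n:ℝ) - 1)) + α) = 0 := by
  set N := 2 * n - 1 with hN
  have hN0 : (N : ℝ) ≠ 0 := by
    have : 0 < N := by omega
    positivity
  rw [← castN n hn, ← hN]
  set z : ℂ := Complex.exp (2 * π * Complex.I * (q / N)) with hz
  have hN0' : (N : ℂ) ≠ 0 := by exact_mod_cast hN0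
  have hzN : z ^ N = 1 := by
    rw [hz, ← Complex.exp_nat_mul, Complex.exp_eq_one_iff]
    refine ⟨q, ?_⟩
    field_simp
  have hz1 : z ≠ 1 := by
    rw [hz, Ne, Complex.exp_eq_one_iff]
    rintro ⟨m, hm⟩
    apply hq
    refine ⟨m, ?_⟩
    have h2 : (2 * π * Complex.I : ℂ) ≠ 0 := by simp [Real.pi_ne_zero]
    have : (q / N : ℂ) = m := by
      apply mul_left_cancel₀ h2
      rw [hm]; ring
    rw [div_eq_iff hN0'] at this
    have h3 : (q : ℂ) = ((N * m : ℤ) : ℂ) := by push_cast; rw [this]; ring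
    exact_mod_cast h3
  have hs : ∑ j ∈ Finset.range N, z ^ j = 0 := by
    have := mul_geom_sum z N
    rw [hzN, sub_self] at this
    exact (mul_eq_zero.mp this).resolve_left (sub_ne_zero.mpr hz1)
  have h4 : ∀ j : ℕ, cos (q * (2 * (j:ℝ) * π / (N:ℝ)) + α) =
      (Complex.exp (α * Complex.I) * z ^ j).re := by
    intro j
    rw [hz, ← Complex.exp_nat_mul, ← Complex.exp_add, ← Complex.exp_ofReal_mul_I_re]
    congr 2
    push_cast
    field_simp
    ring
  simp_rw [h4]
  rw [← Complex.re_sum, ← Finset.mul_sum, hs]; simp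

lemma sum_cos_nodes0 (n : ℕ) (hn : 1 ≤ n) (α : ℝ) :
    ∑ j ∈ Finset.range (2 * n - 1), cos (((0:ℤ):ℝ) * (2 * (j:ℝ) * π / (2 * (n:ℝ) - 1)) + α)
      = (2 * (n:ℝ) - 1) * cos α := by
  simp [castN n hn]

lemma Npos (n : ℕ) (hn : 1 ≤ n) : (0:ℝ) < 2 * (n:ℝ) - 1 := by
  have : (1:ℝ) ≤ n := by exact_mod_cast hn
  linarith

lemma Lag_cos (n : ℕ) (hn : 1 ≤ n) (r : ℕ) (hr : r ≤ n - 1) (θ x : ℝ) :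
    Lag n (fun y => cos (r * y - θ)) x = cos (r * x - θ) := by
  unfold Lag
  have hNp := Npos n hn
  set X : ℕ → ℝ := fun j => 2 * (j:ℝ) * π / (2 * (n:ℝ) - 1) with hX
  have e1 : ∀ j : ℕ, cos (r * X j - θ) * (1 + 2 * ∑ m ∈ Finset.Icc 1 (n - 1), cos (m * (x - X j)))
      = cos (((r:ℤ):ℝ) * X j + (-θ)) + ∑ m ∈ Finset.Icc 1 (n - 1),
        (cos (((r - m : ℤ):ℝ) * X j + (m * x - θ)) + cos (((r + m : ℤ):ℝ) * X j + (-(m * x) - θ))) := by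
    intro j
    rw [mul_add, mul_one, Finset.mul_sum, Finset.mul_sum]
    congr 1
    apply Finset.sum_congr rfl
    intro m _
    have h1 : ((r - m : ℤ):ℝ) * X j + (m * x - θ) = (r * X j - θ) + m * (x - X j) := by
      push_cast; ring
    have h2 : ((r + m : ℤ):ℝ) * X j + (-(m * x) - θ) = (r * X j - θ) - m * (x - X j) := by
      push_cast; ring
    rw [h1, h2, cos_add (r * X j - θ), cos_sub (r * X j - θ)]; ring
  have e2 : ∑ j ∈ Finset.range (2 * n - 1), cos (r * X j - θ) *
      (1 + 2 * ∑ m ∈ Finset.Icc 1 (n - 1), cos (m * (x - X j))) = (2 * (n:ℝ) - 1) * cos (r * x - θ) := by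
    simp_rw [e1]
    rw [Finset.sum_add_distrib, Finset.sum_comm]
    simp_rw [Finset.sum_add_distrib]
    have z2 : ∀ m ∈ Finset.Icc 1 (n - 1), ∑ j ∈ Finset.range (2 * n - 1),
        cos (((r + m : ℤ):ℝ) * X j + (-(m * x) - θ)) = 0 := by
      intro m hm
      rw [Finset.mem_Icc] at hm
      apply sum_cos_nodes n hn
      intro hd
      have := Int.le_of_dvd (by omega) hd
      omega
    rw [Finset.sum_eq_zero z2, add_zero]
    have z1 : ∀ m ∈ Finset.Icc 1 (n - 1), m ≠ r → ∑ j ∈ Finset.range (2 * n - 1),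
        cos (((r - m : ℤ):ℝ) * X j + (m * x - θ)) = 0 := by
      intro m hm hne
      rw [Finset.mem_Icc] at hm
      apply sum_cos_nodes n hn
      intro hd
      have := Int.eq_zero_of_abs_lt_dvd hd (by rw [abs_lt]; omega)
      omega
    rcases Nat.eq_zero_or_pos r with h0 | h0
    · subst h0
      rw [add_comm, Finset.sum_eq_zero]
      · have := sum_cos_nodes0 n hn (-θ)
        simpa [hX] using this
      · intro m hm
        apply z1 m hm
        rw [Finset.mem_Icc] at hm; omega
    · rw [Finset.sum_eq_single r z1 (by intro h; exact absurd (Finset.mem_Icc.mpr ⟨h0, hr⟩) h)]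
      rw [sum_cos_nodes n hn r]
      · rw [sub_self]
        rw [zero_add, hX]; exact sum_cos_nodes0 n hn _
      · intro hd
        have := Int.le_of_dvd (by omega) hd
        omega
  rw [e2]; field_simp

lemma Lag_isTrig (n : ℕ) (g : ℝ → ℝ) : IsTrigPolyDeg (n - 1) (Lag n g) := by
  set X : ℕ → ℝ := fun j => 2 * (j:ℝ) * π / (2 * (n:ℝ) - 1) with hX
  refine ⟨fun k => 2 * (1 / (2 * (n:ℝ) - 1)) * ∑ j ∈ Finset.range (2 * n - 1), g (X j) * cos (k * X j),
    fun k => 2 * (1 / (2 * (n:ℝ) - 1)) * ∑ j ∈ Finset.range (2 * n - 1), g (X j) * sin (k * X j), ?_⟩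
  intro x
  have : Lag n g x = (1 / (2 * (n:ℝ) - 1)) * ∑ j ∈ Finset.range (2 * n - 1),
    (g (X j) + ∑ m ∈ Finset.Icc 1 (n - 1), 2 * (g (X j) * cos (m * X j) * cos (m * x) +
      g (X j) * sin (m * X j) * sin (m * x))) := by
    unfold Lag
    congr 1
    apply Finset.sum_congr rfl
    intro j _
    rw [mul_add, mul_one, Finset.mul_sum, Finset.mul_sum]
    congr 1
    apply Finset.sum_congr rfl
    intro m _
    rw [mul_sub, cos_sub]; ring
  rw [this, Finset.sum_add_distrib, Finset.sum_comm, mul_add]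
  congr 1
  · simp only [Nat.cast_zero, zero_mul, cos_zero, mul_one]; ring
  · rw [Finset.mul_sum]
    apply Finset.sum_congr rfl
    intro m _
    rw [← Finset.mul_sum, Finset.sum_add_distrib, ← Finset.sum_mul, ← Finset.sum_mul]
    ring

lemma Lag_congr (n : ℕ) (f g : ℝ → ℝ)
    (h : ∀ k : ℤ, f (2 * (k:ℝ) * π / (2 * (n:ℝ) - 1)) = g (2 * (k:ℝ) * π / (2 * (n:ℝ) - 1))) :
    Lag n f = Lag n g := by
  funext x
  unfold Lag
  congr 1
  apply Finset.sum_congr rfl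
  intro j _
  have := h j
  push_cast at this
  rw [this]

lemma Lag_add (n : ℕ) (f g : ℝ → ℝ) (x : ℝ) :
    Lag n (fun y => f y + g y) x = Lag n f x + Lag n g x := by
  unfold Lag
  rw [← mul_add, ← Finset.sum_add_distrib]
  simp_rw [add_mul]

lemma Lag_smul (n : ℕ) (c : ℝ) (f : ℝ → ℝ) (x : ℝ) :
    Lag n (fun y => c * f y) x = c * Lag n f x := by
  unfold Lag
  rw [mul_left_comm, Finset.mul_sum _ _ c]
  simp_rw [mul_assoc]

lemma Lag_sum (n : ℕ) {ι : Type} (s : Finset ι) (f : ι → ℝ → ℝ) (x : ℝ) :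
    Lag n (fun y => ∑ i ∈ s, f i y) x = ∑ i ∈ s, Lag n (f i) x := by
  unfold Lag
  rw [← Finset.mul_sum, Finset.sum_comm]
  simp_rw [Finset.sum_mul]

lemma Lag_trig (n : ℕ) (hn : 1 ≤ n) (T : ℝ → ℝ) (hT : IsTrigPolyDeg (n - 1) T) : Lag n T = T := by
  obtain ⟨a, b, h⟩ := hT
  have hT : T = fun x => a 0 / 2 * cos ((0:ℕ) * x - 0) +
    ∑ k ∈ Finset.Icc 1 (n - 1), (a k * cos (k * x - 0) + b k * cos (k * x - π / 2)) := by
    funext x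
    rw [h]; simp [cos_sub_pi_div_two]
  funext x
  rw [hT, Lag_add, Lag_smul, Lag_sum, Lag_cos n hn 0 (by omega)]
  congr 1
  apply Finset.sum_congr rfl
  intro k hk
  rw [Finset.mem_Icc] at hk
  rw [Lag_add, Lag_smul, Lag_smul, Lag_cos n hn k hk.2, Lag_cos n hn k hk.2]

lemma Lag_hasSum (n : ℕ) (f : ℝ → ℝ) (F : ℕ → ℝ → ℝ) (h : ∀ x, HasSum (fun k => F k x) (f x)) (x : ℝ) :
    HasSum (fun k => Lag n (F k) x) (Lag n f x) := by
  unfold Lag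
  apply HasSum.mul_left
  apply hasSum_sum
  intro j _
  apply HasSum.mul_right
  apply h

lemma node_shift (n : ℕ) (hn : 1 ≤ n) (q k : ℤ) (α : ℝ) :
    cos ((q * (2 * (n:ℝ) - 1)) * (2 * (k:ℝ) * π / (2 * (n:ℝ) - 1)) + α) = cos α := by
  have := Npos n hn
  have h : (q * (2 * (n:ℝ) - 1)) * (2 * (k:ℝ) * π / (2 * (n:ℝ) - 1)) + α
    = α + ((q * k : ℤ) : ℝ) * (2 * π) := by
    push_cast; field_simp; ring
  rw [h, cos_add_int_mul_two_pi]

/-- Aliasing. -/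
lemma alias_ex (n : ℕ) (hn : 1 ≤ n) (k : ℕ) (θ : ℝ) : ∃ r : ℕ, ∃ θ' : ℝ, r ≤ n - 1 ∧
    (∀ x, Lag n (fun y => cos (k * y - θ)) x = cos (r * x - θ')) ∧
    ∀ j : ℤ, cos (r * (2 * (j:ℝ) * π / (2 * (n:ℝ) - 1)) - θ') =
      cos (k * (2 * (j:ℝ) * π / (2 * (n:ℝ) - 1)) - θ) := by
  suffices H : ∃ r : ℕ, ∃ θ' : ℝ, r ≤ n - 1 ∧ ∀ j : ℤ,
      cos (r * (2 * (j:ℝ) * π / (2 * (n:ℝ) - 1)) - θ') =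
      cos (k * (2 * (j:ℝ) * π / (2 * (n:ℝ) - 1)) - θ) by
    obtain ⟨r, θ', hr, h⟩ := H
    refine ⟨r, θ', hr, fun x => ?_, h⟩
    rw [Lag_congr n _ (fun y => cos (r * y - θ')) (fun j => (h j).symm), Lag_cos n hn r hr]
  have hdm := Nat.div_add_mod k (2 * n - 1)
  have hlt := Nat.mod_lt k (show 2 * n - 1 > 0 by omega)
  set q := k / (2 * n - 1)
  set r := k % (2 * n - 1)
  have hk : (k:ℝ) = q * (2 * (n:ℝ) - 1) + r := by
    rw [← castN n hn, ← hdm]; push_cast; ring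
  by_cases h : r ≤ n - 1
  · refine ⟨r, θ, h, fun j => ?_⟩
    rw [← node_shift n hn q j]
    congr 1
    rw [hk]; push_cast; ring
  · refine ⟨2 * n - 1 - r, -θ, by omega, fun j => ?_⟩
    rw [← cos_neg, ← node_shift n hn (q + 1) j]
    congr 1
    rw [hk, Nat.cast_sub hlt.le, castN n hn]; push_cast; ring

lemma Lag_cos_n (n : ℕ) (hn : 1 ≤ n) (θ x : ℝ) :
    cos (n * x - θ) - Lag n (fun y => cos (n * y - θ)) x =
      -2 * (sin ((2 * (n:ℝ) - 1) * x / 2) * sin (x / 2 - θ)) := by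
  have e : Lag n (fun y => cos (n * y - θ)) = Lag n (fun y => cos ((n - 1 : ℕ) * y - (-θ))) := by
    apply Lag_congr n
    intro j
    symm
    rw [← cos_neg (((n - 1 : ℕ):ℝ) * _ - _), ← node_shift n hn 1 j]
    congr 1
    rw [Nat.cast_sub hn]; push_cast; ring
  rw [e, Lag_cos n hn (n - 1) le_rfl, cos_sub_cos]
  rw [Nat.cast_sub hn]; push_cast
  have h1 : ((n:ℝ) * x - θ + ((n - 1) * x - -θ)) / 2 = (2 * (n:ℝ) - 1) * x / 2 := by ring
  have h2 : ((n:ℝ) * x - θ - ((n - 1) * x - -θ)) / 2 = x / 2 - θ := by ring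
  rw [h1, h2]; ring

lemma LpPer_eq (p : ℝ≥0∞) {f : ℝ → ℝ} (hf : Continuous f) :
    LpNormPer p f = lpNorm f p (volume.restrict (Ioc (0:ℝ) (2*π))) :=
  toReal_eLpNorm hf.aestronglyMeasurable

lemma memLp_per (p : ℝ≥0∞) {f : ℝ → ℝ} (hf : Continuous f) :
    MemLp f p (volume.restrict (Ioc (0:ℝ) (2*π))) := by
  obtain ⟨C, hC⟩ := (isCompact_Icc (a := (0:ℝ)) (b := 2*π)).exists_bound_of_continuousOn hf.continuousOn
  refine MemLp.of_bound hf.aestronglyMeasurable C ?_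
  rw [ae_restrict_iff' measurableSet_Ioc]
  exact .of_forall fun x hx => hC x ⟨hx.1.le, hx.2⟩

lemma LpPer_nonneg (p : ℝ≥0∞) (f : ℝ → ℝ) : 0 ≤ LpNormPer p f := ENNReal.toReal_nonneg

lemma LpPer_bound (p : ℝ≥0∞) (hp : 1 ≤ p) {f : ℝ → ℝ} {M : ℝ} (hM : 0 ≤ M)
    (h : ∀ x, |f x| ≤ M) : LpNormPer p f ≤ 2 * π * M := by
  unfold LpNormPer
  have h1 := eLpNorm_le_of_ae_bound (p := p) (μ := volume.restrict (Ioc (0:ℝ) (2*π)))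
    (f := f) (C := M) (.of_forall h)
  have h2 : (volume.restrict (Ioc (0:ℝ) (2*π))) Set.univ ^ p.toReal⁻¹ ≤ ENNReal.ofReal (2 * π) := by
    rw [Measure.restrict_apply_univ, Real.volume_Ioc, sub_zero]
    conv_rhs => rw [← ENNReal.rpow_one (ENNReal.ofReal (2 * π))]
    apply ENNReal.rpow_le_rpow_of_exponent_le
    · rw [ENNReal.one_le_ofReal]; linarith [pi_gt_three]
    · by_cases ht : p = ∞
      · simp [ht]
      · apply inv_le_one_of_one_le₀
        rw [← ENNReal.toReal_one]
        exact ENNReal.toReal_mono ht hp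
  refine ENNReal.toReal_le_of_le_ofReal (by positivity) (h1.trans ?_)
  rw [ENNReal.ofReal_mul (by positivity)]
  gcongr

lemma LpPer_sub_le (p : ℝ≥0∞) (hp : 1 ≤ p) {f g : ℝ → ℝ} (hf : Continuous f) (hg : Continuous g)
    {M : ℝ} (h : ∀ x, |f x - g x| ≤ M) : |LpNormPer p f - LpNormPer p g| ≤ 2 * π * M := by
  have hM : 0 ≤ M := (abs_nonneg _).trans (h 0)
  have h1 := lpNorm_le_lpNorm_add_lpNorm_sub' (f := f) (memLp_per p hg) hp
  have h2 := lpNorm_le_lpNorm_add_lpNorm_sub (f := g) (memLp_per p hf) hp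
  have h3 := LpPer_bound p hp hM h
  have h4 : LpNormPer p (fun x => f x - g x) = lpNorm (f - g) p (volume.restrict (Ioc (0:ℝ) (2*π))) :=
    LpPer_eq p (hf.sub hg)
  rw [← LpPer_eq p hf, ← LpPer_eq p hg, ← h4] at h1 h2
  rw [abs_le]; constructor <;> linarith

lemma LpPer_mul (p : ℝ≥0∞) (c : ℝ) {f : ℝ → ℝ} :
    LpNormPer p (fun x => c * f x) = |c| * LpNormPer p f := by
  unfold LpNormPer
  have := eLpNorm_const_smul c f p (volume.restrict (Ioc (0:ℝ) (2*π)))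
  have h2 : (c • f) = fun x => c * f x := by ext; simp
  rw [h2] at this
  rw [this, ENNReal.toReal_mul]; simp

lemma LpPer_pow (p : ℝ≥0∞) (hp : 1 ≤ p) (ht : p ≠ ∞) {f : ℝ → ℝ} (hf : Continuous f) :
    LpNormPer p f = (∫ x in (0:ℝ)..(2*π), |f x| ^ p.toReal) ^ p.toReal⁻¹ := by
  rw [LpPer_eq p hf, lpNorm_eq_integral_norm_rpow_toReal (by positivity) ht hf.aestronglyMeasurable,
    intervalIntegral.integral_of_le (by positivity)]
  rfl

lemma LpPer_top (f : ℝ → ℝ) (hf : Continuous f) (hper : ∀ x, |f (x + 2 * π)| = |f x|) (x : ℝ) :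
    |f x| ≤ LpNormPer ∞ f := by
  rw [LpPer_eq _ hf]
  have h1 := ae_le_lpNorm_exponent_top (memLp_per ∞ hf)
  set M := lpNorm f ∞ (volume.restrict (Ioc (0:ℝ) (2*π)))
  have h2 : ∀ y ∈ Ioo (0:ℝ) (2 * π), |f y| ≤ M := by
    have hopen : IsOpen ({y | M < |f y|} ∩ Ioo (0:ℝ) (2 * π)) :=
      (isOpen_lt continuous_const hf.abs).inter isOpen_Ioo
    have hz : volume ({y | M < |f y|} ∩ Ioo (0:ℝ) (2 * π)) = 0 := by
      rw [ae_restrict_iff' measurableSet_Ioc, ae_iff] at h1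
      refine measure_mono_null ?_ h1
      rintro y ⟨hy1, hy2⟩
      simp only [mem_ofPred_eq, Real.norm_eq_abs] at *
      intro hc
      exact absurd (hc ⟨hy2.1, hy2.2.le⟩) (not_le.mpr hy1)
    rw [hopen.measure_eq_zero_iff (μ := volume)] at hz
    intro y hy
    by_contra hc
    have : y ∈ ({y | M < |f y|} ∩ Ioo (0:ℝ) (2 * π)) := ⟨not_le.mp hc, hy⟩
    rw [hz] at this
    exact this
  have h3 : ∀ y ∈ Icc (0:ℝ) (2 * π), |f y| ≤ M := by
    rw [← closure_Ioo (by positivity)]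
    intro y hy
    exact le_on_closure h2 hf.abs.continuousOn continuousOn_const hy
  have hP : Function.Periodic (fun x => |f x|) (2 * π) := hper
  obtain ⟨y, hy, he⟩ := hP.exists_mem_Ico₀ (by positivity) x
  rw [show |f x| = |f y| from he]
  exact h3 y ⟨hy.1, hy.2.le⟩

/-- The main oscillating function. -/
noncomputable def Fm (n : ℕ) (θ x : ℝ) : ℝ := sin ((2 * (n:ℝ) - 1) * x / 2) * sin (x / 2 - θ)

lemma Fm_cont (n : ℕ) (θ : ℝ) : Continuous (Fm n θ) := by unfold Fm; fun_prop

lemma Fm_per (n : ℕ) (θ x : ℝ) : |Fm n θ (x + 2 * π)| = |Fm n θ x| := by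
  unfold Fm
  have h1 : (2 * (n:ℝ) - 1) * (x + 2 * π) / 2 = ((2 * (n:ℝ) - 1) * x / 2 - π) + n * (2 * π) := by ring
  have h2 : (x + 2 * π) / 2 - θ = (x / 2 - θ) + π := by ring
  rw [h1, h2, sin_add_nat_mul_two_pi, sin_add_pi, sin_sub_pi, neg_mul_neg]

lemma Fm_shift (n : ℕ) (hn : 1 ≤ n) (θ x : ℝ) :
    |Fm n θ (x + 2 * π / (2 * (n:ℝ) - 1))| = |Fm n (θ - π / (2 * (n:ℝ) - 1)) x| := by
  have := Npos n hn
  unfold Fm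
  have h1 : (2 * (n:ℝ) - 1) * (x + 2 * π / (2 * (n:ℝ) - 1)) / 2 = (2 * (n:ℝ) - 1) * x / 2 + π := by
    field_simp
  have h2 : (x + 2 * π / (2 * (n:ℝ) - 1)) / 2 - θ = x / 2 - (θ - π / (2 * (n:ℝ) - 1)) := by ring
  rw [h1, h2, sin_add_pi, neg_mul, abs_neg]

lemma abs_Fm_le (n : ℕ) (θ x : ℝ) : |Fm n θ x| ≤ 1 := by
  unfold Fm
  rw [abs_mul]
  exact mul_le_one₀ (abs_sin_le_one _) (abs_nonneg _) (abs_sin_le_one _)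

lemma abs_sin_sub_le (a b : ℝ) : |sin a - sin b| ≤ |a - b| := by
  rw [sin_sub_sin, abs_mul, abs_mul]
  have h1 : |sin ((a - b) / 2)| ≤ |(a - b) / 2| := abs_sin_le_abs
  have h2 := abs_cos_le_one ((a + b) / 2)
  have h3 : |(a - b) / 2| = |a - b| / 2 := by rw [abs_div]; norm_num
  rw [h3] at h1
  have h4 : |(2:ℝ)| = 2 := by norm_num
  rw [h4]
  nlinarith [abs_nonneg (sin ((a - b) / 2)), abs_nonneg (cos ((a + b) / 2))]

lemma Fm_lip (n : ℕ) (θ θ' x : ℝ) : |Fm n θ x - Fm n θ' x| ≤ |θ - θ'| := by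
  unfold Fm
  rw [← mul_sub, abs_mul]
  have h := abs_sin_sub_le (x / 2 - θ) (x / 2 - θ')
  have h1 : |x / 2 - θ - (x / 2 - θ')| = |θ - θ'| := by rw [← abs_neg]; congr 1; ring
  rw [h1] at h
  have h2 := abs_sin_le_one ((2 * (n:ℝ) - 1) * x / 2)
  nlinarith [abs_nonneg (sin ((2 * (n:ℝ) - 1) * x / 2)), abs_nonneg (sin (x / 2 - θ) - sin (x / 2 - θ'))]

noncomputable def Am (p : ℝ≥0∞) (n : ℕ) (θ : ℝ) : ℝ := LpNormPer p (Fm n θ)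

lemma Am_near (p : ℝ≥0∞) (hp : 1 ≤ p) (n : ℕ) (θ θ' : ℝ) :
    |Am p n θ - Am p n θ'| ≤ 2 * π * |θ - θ'| :=
  LpPer_sub_le p hp (Fm_cont n θ) (Fm_cont n θ') (Fm_lip n θ θ')

lemma Am_periodic (p : ℝ≥0∞) (hp : 1 ≤ p) (ht : p ≠ ∞) (n : ℕ) (hn : 1 ≤ n) :
    Function.Periodic (Am p n) (π / (2 * (n:ℝ) - 1)) := by
  intro θ
  unfold Am
  rw [LpPer_pow p hp ht (Fm_cont n _), LpPer_pow p hp ht (Fm_cont n _)]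
  congr 1
  have h1 : ∀ x, |Fm n θ x| = |Fm n (θ + π / (2 * (n:ℝ) - 1)) (x + 2 * π / (2 * (n:ℝ) - 1))| := by
    intro x
    rw [Fm_shift n hn]; simp
  simp_rw [h1]
  rw [intervalIntegral.integral_comp_add_right
    (fun x => |Fm n (θ + π / (2 * (n:ℝ) - 1)) x| ^ p.toReal)]
  have hP : Function.Periodic (fun x => |Fm n (θ + π / (2 * (n:ℝ) - 1)) x| ^ p.toReal) (2 * π) := by
    intro x; simp only [Fm_per]
  have := hP.intervalIntegral_add_eq 0 (0 + 2 * π / (2 * (n:ℝ) - 1))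
  rw [zero_add] at this
  rw [this]
  congr 1; ring

lemma Am_close (p : ℝ≥0∞) (hp : 1 ≤ p) (ht : p ≠ ∞) (n : ℕ) (hn : 1 ≤ n) (θ θ' : ℝ) :
    |Am p n θ - Am p n θ'| ≤ 2 * π * (π / (2 * (n:ℝ) - 1)) := by
  have hN := Npos n hn
  obtain ⟨y, hy, he⟩ := (Am_periodic p hp ht n hn).exists_mem_Ico (by positivity) θ' θ
  rw [he, abs_sub_comm]
  refine (Am_near p hp n _ _).trans ?_
  gcongr
  rw [abs_sub_comm] 
  rw [abs_le]; constructor <;> linarith [hy.1, hy.2]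

lemma int_sin_shift (q x : ℝ) :
    ∫ s in (0:ℝ)..(2*π), |sin (x / 2 - s)| ^ q = ∫ x in (0:ℝ)..(2*π), |cos x| ^ q := by
  have h1 : ∀ s, |sin (x / 2 - s)| = |cos (s + (π / 2 - x / 2))| := by
    intro s
    rw [← cos_pi_div_two_sub]; congr 2; ring
  simp_rw [h1]
  rw [intervalIntegral.integral_comp_add_right (fun s => |cos s| ^ q)]
  have hP : Function.Periodic (fun s => |cos s| ^ q) (2 * π) := by
    intro s; simp
  have := hP.intervalIntegral_add_eq 0 (0 + (π / 2 - x / 2))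
  rw [zero_add] at this
  rw [this]
  congr 1; ring

lemma int_sin_scale (n : ℕ) (hn : 1 ≤ n) (q : ℝ) (hq : 0 ≤ q) :
    ∫ x in (0:ℝ)..(2*π), |sin ((2 * (n:ℝ) - 1) * x / 2)| ^ q = ∫ x in (0:ℝ)..(2*π), |cos x| ^ q := by
  have hN := Npos n hn
  have h0 : ∫ x in (0:ℝ)..(2*π), |sin x| ^ q = ∫ x in (0:ℝ)..(2*π), |cos x| ^ q := by
    rw [← int_sin_shift q 0]
    simp
  have hc : Continuous (fun s => |sin s| ^ q) := by
    apply Continuous.rpow_const (by fun_prop)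
    intro x; right; exact hq
  have hP : Function.Periodic (fun s => |sin s| ^ q) π := by
    intro s; simp
  have h2 := hP.intervalIntegral_add_zsmul_eq 2 0 (fun _ _ => hc.intervalIntegrable _ _)
  have h3 := hP.intervalIntegral_add_zsmul_eq (2 * n - 1) 0 (fun _ _ => hc.intervalIntegrable _ _)
  have e : ∀ x : ℝ, (2 * (n:ℝ) - 1) * x / 2 = ((2 * (n:ℝ) - 1) / 2) * x := fun x => by ring
  simp_rw [e]
  rw [intervalIntegral.integral_comp_mul_left (fun s => |sin s| ^ q) (by positivity), ← h0]
  simp only [zero_add, zsmul_eq_mul] at h2 h3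
  push_cast at h2 h3
  rw [mul_zero, show (2 * (n:ℝ) - 1) / 2 * (2 * π) = (2 * (n:ℝ) - 1) * π by ring, h3, h2, smul_eq_mul]
  field_simp

lemma int_G (n : ℕ) (hn : 1 ≤ n) (q : ℝ) (hq : 0 ≤ q) :
    ∫ s in (0:ℝ)..(2*π), ∫ x in (0:ℝ)..(2*π), |Fm n s x| ^ q =
      (∫ x in (0:ℝ)..(2*π), |cos x| ^ q) ^ 2 := by
  have hc : Continuous (fun z : ℝ × ℝ => |Fm n z.1 z.2| ^ q) := by
    apply Continuous.rpow_const
    · unfold Fm; fun_prop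
    · intro x; right; exact hq
  rw [intervalIntegral_intervalIntegral_swap (F := fun s x => |Fm n s x| ^ q)]
  · have e : ∀ x, ∫ s in (0:ℝ)..(2*π), |Fm n s x| ^ q =
        |sin ((2 * (n:ℝ) - 1) * x / 2)| ^ q * ∫ x in (0:ℝ)..(2*π), |cos x| ^ q := by
      intro x
      rw [← int_sin_shift q x, ← intervalIntegral.integral_const_mul]
      congr 1; ext s
      unfold Fm
      rw [abs_mul, mul_rpow (abs_nonneg _) (abs_nonneg _)]
    simp_rw [e]
    rw [intervalIntegral.integral_mul_const, int_sin_scale n hn q hq, sq]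
  · have : IntegrableOn (fun z : ℝ × ℝ => |Fm n z.1 z.2| ^ q) (Icc 0 (2*π) ×ˢ Icc 0 (2*π)) :=
      hc.continuousOn.integrableOn_compact (isCompact_Icc.prod isCompact_Icc)
    refine this.mono_set ?_
    rw [uIoc_of_le (by positivity)]
    exact Set.prod_mono Ioc_subset_Icc_self Ioc_subset_Icc_self

/-- The limiting value. -/
noncomputable def Tm (p : ℝ≥0∞) : ℝ := (2 * π) ^ (-(1 / p.toReal)) * cosLp p ^ 2

lemma Tm_finite (p : ℝ≥0∞) (hp : 1 ≤ p) (ht : p ≠ ∞) (n : ℕ) (hn : 1 ≤ n) (θ : ℝ) :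
    |Am p n θ - Tm p| ≤ 2 * π * (π / (2 * (n:ℝ) - 1)) := by
  set ε := 2 * π * (π / (2 * (n:ℝ) - 1)) with hε
  set q := p.toReal with hq
  have hN := Npos n hn
  have hε0 : 0 < ε := by positivity
  have hq1 : 1 ≤ q := by
    rw [← ENNReal.toReal_one]; exact ENNReal.toReal_mono ht hp
  have hq0 : 0 < q := by linarith
  set J := ∫ x in (0:ℝ)..(2*π), |cos x| ^ q with hJ
  have hJ0 : 0 ≤ J := intervalIntegral.integral_nonneg (by positivity) (fun x _ => by positivity)
  have hcos : cosLp p = J ^ q⁻¹ := LpPer_pow p hp ht continuous_cos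
  have hT0 : 0 ≤ Tm p := by
    unfold Tm; have := pi_pos; positivity
  have hTq : 2 * π * Tm p ^ q = J ^ 2 := by
    unfold Tm
    rw [mul_rpow (by positivity) (by positivity), ← rpow_mul (by positivity), hcos, ← hq,
      ← rpow_natCast, ← rpow_mul hJ0, ← rpow_mul hJ0]
    rw [show -(1 / q) * q = -1 by field_simp, show q⁻¹ * ((2:ℕ):ℝ) * q = ((2:ℕ):ℝ) by field_simp,
      rpow_neg_one, rpow_natCast]
    field_simp
  have hA0 : ∀ s, 0 ≤ Am p n s := fun s => LpPer_nonneg _ _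
  have hG : ∀ s, Am p n s ^ q = ∫ x in (0:ℝ)..(2*π), |Fm n s x| ^ q := by
    intro s
    unfold Am
    rw [LpPer_pow p hp ht (Fm_cont n s), ← hq, ← rpow_mul, inv_mul_cancel₀ hq0.ne', rpow_one]
    exact intervalIntegral.integral_nonneg (by positivity) (fun x _ => by positivity)
  have hI : ∫ s in (0:ℝ)..(2*π), Am p n s ^ q = J ^ 2 := by
    simp_rw [hG]; exact int_G n hn q hq0.le
  have hAc : Continuous (Am p n) := by
    refine LipschitzWith.continuous (K := ⟨2 * π, by positivity⟩) ?_
    refine LipschitzWith.of_dist_le_mul ?_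
    intro a b
    exact Am_near p hp n a b
  have hAqc : Continuous (fun s => Am p n s ^ q) := hAc.rpow_const (fun x => Or.inr hq0.le)
  have hintB : ∀ B : ℝ, ∫ s in (0:ℝ)..(2*π), B ^ q = 2 * π * B ^ q := by
    intro B; simp
  have hclose := Am_close p hp ht n hn
  rw [abs_le]
  constructor
  · -- Tm ≤ Am θ + ε
    have : 2 * π * Tm p ^ q ≤ 2 * π * (Am p n θ + ε) ^ q := by
      rw [hTq, ← hI, ← hintB]
      apply intervalIntegral.integral_mono_on (by positivity)
      · exact hAqc.intervalIntegrable _ _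
      · simp
      · intro s _
        apply rpow_le_rpow (hA0 s) _ hq0.le
        have := abs_le.mp (hclose s θ)
        linarith [this.2]
    have := le_of_mul_le_mul_left this (by positivity)
    rw [rpow_le_rpow_iff hT0 (by linarith [hA0 θ]) hq0] at this
    linarith
  · rcases le_total (Am p n θ - ε) 0 with h | h
    · linarith
    have : 2 * π * (Am p n θ - ε) ^ q ≤ 2 * π * Tm p ^ q := by
      rw [hTq, ← hI, ← hintB]
      apply intervalIntegral.integral_mono_on (by positivity)
      · simp
      · exact hAqc.intervalIntegrable _ _
      · intro s _
        apply rpow_le_rpow h _ hq0.le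
        have := abs_le.mp (hclose s θ)
        linarith [this.1]
    have := le_of_mul_le_mul_left this (by positivity)
    rw [rpow_le_rpow_iff h hT0 hq0] at this
    linarith

lemma LpPer_top_le {f : ℝ → ℝ} {M : ℝ} (hM : 0 ≤ M) (h : ∀ x, |f x| ≤ M) : LpNormPer ∞ f ≤ M := by
  unfold LpNormPer
  have h1 := eLpNorm_le_of_ae_bound (p := ∞) (μ := volume.restrict (Ioc (0:ℝ) (2*π)))
    (f := f) (C := M) (.of_forall h)
  refine ENNReal.toReal_le_of_le_ofReal hM (h1.trans ?_)
  simp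

lemma Tm_top : Tm ∞ = 1 := by
  unfold Tm
  have h1 : cosLp ∞ ≤ 1 := LpPer_top_le zero_le_one abs_cos_le_one
  have h2 : |cos 0| ≤ cosLp ∞ := LpPer_top cos continuous_cos (by simp) 0
  simp at h2
  have : cosLp ∞ = 1 := le_antisymm h1 h2
  simp [this]

lemma Tm_inf (n : ℕ) (hn : 1 ≤ n) (θ : ℝ) :
    |Am ∞ n θ - Tm ∞| ≤ 2 * π * (π / (2 * (n:ℝ) - 1)) := by
  have hN := Npos n hn
  rw [Tm_top]
  have h1 : Am ∞ n θ ≤ 1 := LpPer_top_le zero_le_one (abs_Fm_le n θ)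
  -- choose a node
  set N := 2 * (n:ℝ) - 1
  have hδ : 0 < π / N := by positivity
  set j : ℤ := ⌊(θ + π / 2) / (π / N)⌋
  set x : ℝ := (2 * j + 1) * π / N with hx
  have hs1 : |sin (N * x / 2)| = 1 := by
    have : N * x / 2 = π / 2 + j * π := by rw [hx]; field_simp; ring
    rw [this, sin_add_int_mul_pi]
    simp
  have hdist : |x / 2 - (θ + π / 2)| ≤ π / N := by
    have hl := Int.floor_le ((θ + π / 2) / (π / N))
    have hu := Int.lt_floor_add_one ((θ + π / 2) / (π / N))
    rw [le_div_iff₀ hδ] at hl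
    rw [div_lt_iff₀ hδ] at hu
    have : x / 2 = j * (π / N) + (π / N) / 2 := by rw [hx]; field_simp
    change (j:ℝ) * (π / N) ≤ θ + π / 2 at hl
    change θ + π / 2 < ((j:ℝ) + 1) * (π / N) at hu
    rw [add_mul, one_mul] at hu
    rw [this, abs_le]
    constructor <;> linarith
  have hs2 : 1 - π / N ≤ |sin (x / 2 - θ)| := by
    have h := abs_sin_sub_le (x / 2 - θ) (π / 2)
    rw [show x / 2 - θ - π / 2 = x / 2 - (θ + π / 2) by ring, sin_pi_div_two] at h
    have h3 := (abs_le.mp (h.trans hdist)).1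
    linarith [le_abs_self (sin (x / 2 - θ))]
  have h2 : 1 - π / N ≤ Am ∞ n θ := by
    refine le_trans ?_ (LpPer_top (Fm n θ) (Fm_cont n θ) (Fm_per n θ) x)
    unfold Fm
    rw [abs_mul, hs1, one_mul]; exact hs2
  rw [abs_le]
  constructor <;> nlinarith [pi_gt_three]

lemma Tm_all (p : ℝ≥0∞) (hp : 1 ≤ p) (n : ℕ) (hn : 1 ≤ n) (θ : ℝ) :
    |Am p n θ - Tm p| ≤ 2 * π ^ 2 / n := by
  have hN := Npos n hn
  have hn' : (1:ℝ) ≤ n := by exact_mod_cast hn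
  have h : |Am p n θ - Tm p| ≤ 2 * π * (π / (2 * (n:ℝ) - 1)) := by
    by_cases ht : p = ∞
    · subst ht; exact Tm_inf n hn θ
    · exact Tm_finite p hp ht n hn θ
  refine h.trans ?_
  rw [show 2 * π * (π / (2 * (n:ℝ) - 1)) = 2 * π ^ 2 / (2 * (n:ℝ) - 1) by ring]
  gcongr
  linarith

lemma Tm_nonneg (p : ℝ≥0∞) : 0 ≤ Tm p := by
  unfold Tm; have := pi_pos; positivity

lemma main_const (p : ℝ≥0∞) :
    2 ^ ((1:ℝ) - 1/p.toReal) / π ^ ((1:ℝ) + 1/p.toReal) * (cosLp p) ^ 2 = (2 / π) * Tm p := by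
  unfold Tm
  have := pi_pos
  rw [rpow_sub (by norm_num), rpow_add (by positivity), rpow_neg (by positivity),
    mul_rpow (by norm_num) (by positivity), rpow_one, rpow_one]
  field_simp

section series
variable (n : ℕ) (f : ℝ → ℝ) (c θ : ℕ → ℝ)

lemma ser_interp (hn : 1 ≤ n) (h : ∀ x, HasSum (fun k => c k * cos (k * x - θ k)) (f x)) :
    InterpolatesAt n (Lag n f) f := by
  refine ⟨Lag_isTrig n f, fun j => ?_⟩
  have h1 := Lag_hasSum n f (fun k x => c k * cos (k * x - θ k)) h
    (2 * (j:ℝ) * π / (2 * (n:ℝ) - 1))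
  refine h1.unique ?_
  convert h (2 * (j:ℝ) * π / (2 * (n:ℝ) - 1)) using 2 with k
  rw [Lag_smul]
  obtain ⟨r, θ', _, h2, h3⟩ := alias_ex n hn k (θ k)
  rw [h2, h3]

lemma ser_unique (hn : 1 ≤ n) (T : ℝ → ℝ) (hT : InterpolatesAt n T f) : T = Lag n f := by
  rw [← Lag_trig n hn T hT.1]
  exact Lag_congr n _ _ hT.2

lemma trig_cont (m : ℕ) (T : ℝ → ℝ) (hT : IsTrigPolyDeg m T) : Continuous T := by
  obtain ⟨a, b, h⟩ := hT
  rw [show T = _ from funext h]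
  fun_prop

lemma ser_cont (h : ∀ x, HasSum (fun k => c k * cos (k * x - θ k)) (f x))
    (hc : Summable (fun k => |c k|)) : Continuous f := by
  have : f = fun x => ∑' k, c k * cos (k * x - θ k) := funext fun x => (h x).tsum_eq.symm
  rw [this]
  refine continuous_tsum (fun k => by fun_prop) hc ?_
  intro k x
  rw [Real.norm_eq_abs, abs_mul]
  exact mul_le_of_le_one_right (abs_nonneg _) (abs_cos_le_one _)

lemma ser_err (p : ℝ≥0∞) (hp : 1 ≤ p) (hn : 1 ≤ n)
    (h : ∀ x, HasSum (fun k => c k * cos (k * x - θ k)) (f x))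
    (hc : Summable (fun k => |c k|)) :
    |LpNormPer p (fun x => f x - Lag n f x) - 2 * |c n| * Am p n (θ n)| ≤
      2 * π * (2 * ∑' k, |c (k + (n + 1))|) := by
  have e : 2 * |c n| * Am p n (θ n) = LpNormPer p (fun x => (-2 * c n) * Fm n (θ n) x) := by
    rw [LpPer_mul, abs_mul]; norm_num [Am]
  rw [e]
  refine LpPer_sub_le p hp ?_ ?_ ?_
  · exact (ser_cont f c θ h hc).sub (trig_cont _ _ (Lag_isTrig n f))
  · exact continuous_const.mul (Fm_cont n _)
  intro x
  have h1 := Lag_hasSum n f (fun k x => c k * cos (k * x - θ k)) h x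
  have h2 := (h x).sub h1
  simp_rw [Lag_smul, ← mul_sub] at h2
  rw [← hasSum_nat_add_iff' (n + 1)] at h2
  rw [Finset.sum_range_succ, Finset.sum_eq_zero, zero_add, Lag_cos_n n hn] at h2
  · have hs : Summable (fun k => |c (k + (n + 1))|) := 
      hc.comp_injective (add_left_injective (n + 1))
    have h3 := tsum_of_norm_bounded (hs.hasSum.mul_left 2) (f := fun k => c (k + (n + 1)) *
      (cos (((k + (n + 1) : ℕ):ℝ) * x - θ (k + (n + 1))) -
        Lag n (fun y => cos (((k + (n + 1) : ℕ):ℝ) * y - θ (k + (n + 1)))) x)) ?_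
    · rw [h2.tsum_eq] at h3
      convert! h3 using 1
      rw [Real.norm_eq_abs]; congr 1
      unfold Fm; ring
    · intro k
      obtain ⟨r, θ', _, h4, _⟩ := alias_ex n hn (k + (n + 1)) (θ (k + (n + 1)))
      rw [h4, Real.norm_eq_abs, abs_mul, mul_comm 2]
      refine mul_le_mul_of_nonneg_left ?_ (abs_nonneg _)
      refine (abs_sub _ _).trans ?_
      linarith [abs_cos_le_one (((k + (n + 1) : ℕ):ℝ) * x - θ (k + (n + 1))),
        abs_cos_le_one (r * x - θ')]
  · intro k hk
    rw [Finset.mem_range] at hk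
    rw [Lag_cos n hn k (by omega)]; ring
end series

lemma adm_int {φ : ℝ → ℝ} (h : AdmPhi φ) {g : ℝ → ℝ} (hg : Continuous g) :
    IntervalIntegrable (fun t => g t * φ t) volume 0 (2 * π) := by
  have : IntervalIntegrable φ volume 0 (2 * π) := by
    rw [intervalIntegrable_iff_integrableOn_Ioc_of_le (by positivity)]; exact h.2.1
  exact this.continuousOn_mul hg.continuousOn

lemma adm_bound {φ : ℝ → ℝ} (h : AdmPhi φ) {g : ℝ → ℝ} (hg : Continuous g) (h1 : ∀ t, |g t| ≤ 1) :
    ∫ t in (0:ℝ)..(2*π), |g t * φ t| ≤ 1 := by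
  refine le_trans ?_ h.2.2.2
  apply intervalIntegral.integral_mono_on (by positivity)
  · exact (adm_int h hg).abs
  · have := (adm_int h (g := fun _ => 1) continuous_const).abs
    simpa using this
  · intro t _
    rw [abs_mul]
    exact mul_le_of_le_one_left (abs_nonneg _) (h1 t)

lemma adm_expand {φ : ℝ → ℝ} (h : AdmPhi φ) (k y : ℝ) :
    ∫ t in (0:ℝ)..(2*π), cos (y - k * t) * φ t =
      cos y * (∫ t in (0:ℝ)..(2*π), cos (k * t) * φ t) +
      sin y * (∫ t in (0:ℝ)..(2*π), sin (k * t) * φ t) := by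
  rw [← intervalIntegral.integral_const_mul, ← intervalIntegral.integral_const_mul,
    ← intervalIntegral.integral_add]
  · congr 1; ext t; rw [cos_sub]; ring
  · exact (adm_int h (g := fun t => cos (k * t)) (by fun_prop)).const_mul _
  · exact (adm_int h (g := fun t => sin (k * t)) (by fun_prop)).const_mul _

lemma amp {φ : ℝ → ℝ} (h : AdmPhi φ) (k γ : ℝ) : ∃ ρ θ : ℝ, |ρ| ≤ 1 ∧
    ∀ x, ∫ t in (0:ℝ)..(2*π), cos (k * (x - t) - γ) * φ t = ρ * cos (k * x - θ) := by
  set a := ∫ t in (0:ℝ)..(2*π), cos (k * t) * φ t with ha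
  set b := ∫ t in (0:ℝ)..(2*π), sin (k * t) * φ t with hb
  set z : ℂ := ⟨a, b⟩
  set δ := Complex.arg z
  have h1 : ‖z‖ * cos δ = a := Complex.norm_mul_cos_arg z
  have h2 : ‖z‖ * sin δ = b := Complex.norm_mul_sin_arg z
  have h3 := adm_expand h k δ
  rw [← ha, ← hb] at h3
  have h4 : ∫ t in (0:ℝ)..(2*π), cos (δ - k * t) * φ t = ‖z‖ := by
    rw [h3, ← h1, ← h2]
    linear_combination ‖z‖ * cos_sq_add_sin_sq δ
  refine ⟨‖z‖, γ + δ, ?_, ?_⟩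
  · rw [← h4]
    exact (intervalIntegral.abs_integral_le_integral_abs (by positivity)).trans
      (adm_bound h (by fun_prop) (fun t => abs_cos_le_one _))
  · intro x
    have h5 := adm_expand h k (k * x - γ)
    rw [← ha, ← hb, ← h1, ← h2] at h5
    rw [show k * x - (γ + δ) = (k * x - γ) - δ by ring, cos_sub (k * x - γ)]
    rw [show ‖z‖ * (cos (k * x - γ) * cos δ + sin (k * x - γ) * sin δ) =
      cos (k * x - γ) * (‖z‖ * cos δ) + sin (k * x - γ) * (‖z‖ * sin δ) by ring, ← h5]
    congr 1; ext t; congr 2; ring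

lemma class_rep (ψ βb : ℕ → ℝ) (hψ : ∀ k : ℕ, 1 ≤ k → 0 < ψ k)
    (hs : Summable (fun k : ℕ => ψ (k+1))) (f φ : ℝ → ℝ) (a₀ : ℝ) (h : AdmPhi φ)
    (hf : ∀ x : ℝ, f x = a₀ / 2 + (1/π) * ∫ t in (0:ℝ)..(2*π), ker1 ψ βb (x - t) * φ t)
    (ρ θ : ℕ → ℝ) (hρ : ∀ (k : ℕ) (x : ℝ), ∫ t in (0:ℝ)..(2*π),
      cos ((k + 1 : ℝ) * (x - t) - π * βb (k + 1) / 2) * φ t = ρ k * cos ((k + 1 : ℝ) * x - θ k))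
    (c θ' : ℕ → ℝ) (hc0 : c 0 = a₀ / 2) (hcs : ∀ k, c (k + 1) = 1 / π * (ψ (k + 1) * ρ k))
    (hθ0 : θ' 0 = 0) (hθs : ∀ k, θ' (k + 1) = θ k) (x : ℝ) :
    HasSum (fun k => c k * cos (k * x - θ' k)) (f x) := by
  rw [← hasSum_nat_add_iff' 1]
  simp only [hcs, hθs, Finset.sum_range_one, hc0, hθ0, Nat.cast_zero, zero_mul, sub_zero, cos_zero,
    mul_one]
  rw [hf x, add_sub_cancel_left]
  simp_rw [mul_assoc]
  apply HasSum.mul_left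
  have key := hasSum_integral_of_summable_integral_norm (μ := volume.restrict (Ioc (0:ℝ) (2*π)))
    (F := fun (k : ℕ) t => ψ (k + 1) * (cos ((k + 1 : ℝ) * (x - t) - π * βb (k + 1) / 2) * φ t)) ?_ ?_
  · have eF : ∀ k : ℕ, (∫ t in Ioc (0:ℝ) (2*π), ψ (k + 1) *
        (cos ((k + 1 : ℝ) * (x - t) - π * βb (k + 1) / 2) * φ t)) =
        ψ (k + 1) * (ρ k * cos ((k + 1 : ℝ) * x - θ k)) := by
      intro k
      rw [integral_const_mul, ← intervalIntegral.integral_of_le (by positivity), hρ]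
    simp only [eF] at key
    push_cast
    have eI : ∀ a b : ℝ, a = b → HasSum (fun k : ℕ => ψ (k + 1) * (ρ k * cos ((k + 1 : ℝ) * x - θ k))) b →
        HasSum (fun k : ℕ => ψ (k + 1) * (ρ k * cos ((k + 1 : ℝ) * x - θ k))) a := by
      intro a b hab hb; rwa [hab]
    refine eI _ _ ?_ key
    · rw [intervalIntegral.integral_of_le (by positivity)]
      congr 1; ext t
      unfold ker1
      rw [← tsum_mul_right]
      simp_rw [mul_assoc]
  · intro k
    apply Integrable.const_mul
    have := adm_int h (g := fun t => cos ((k + 1 : ℝ) * (x - t) - π * βb (k + 1) / 2)) (by fun_prop)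
    rwa [intervalIntegrable_iff_integrableOn_Ioc_of_le (by positivity)] at this
  · refine Summable.of_nonneg_of_le (fun k => integral_nonneg fun t => norm_nonneg _) ?_ hs
    intro k
    simp_rw [norm_mul (ψ (k + 1)), integral_const_mul]
    rw [Real.norm_eq_abs, abs_of_pos (hψ _ (by omega))]
    apply mul_le_of_le_one_right (hψ _ (by omega)).le
    rw [← intervalIntegral.integral_of_le (by positivity)]
    exact adm_bound h (by fun_prop) (fun t => abs_cos_le_one _)

lemma four_aux (S : ℝ) : 2 * π * (2 * (1 / π * S)) = 4 * S := by
  have := pi_pos.ne'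
  field_simp
  ring

/-- Error formula for a member of the class, given amplitude `ρ n` at frequency `n`. -/
lemma class_err (p : ℝ≥0∞) (hp : 1 ≤ p) (ψ βb : ℕ → ℝ) (hψ : ∀ k : ℕ, 1 ≤ k → 0 < ψ k)
    (hs : Summable (fun k : ℕ => ψ (k+1))) (n : ℕ) (hn : 1 ≤ n) (f φ : ℝ → ℝ) (a₀ : ℝ) (h : AdmPhi φ)
    (hf : ∀ x : ℝ, f x = a₀ / 2 + (1/π) * ∫ t in (0:ℝ)..(2*π), ker1 ψ βb (x - t) * φ t)
    (ρ₀ θ₀ : ℝ) (hρ₀ : |ρ₀| ≤ 1) (hρ : ∀ x, ∫ t in (0:ℝ)..(2*π),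
      cos ((n : ℝ) * (x - t) - π * βb n / 2) * φ t = ρ₀ * cos (n * x - θ₀)) :
    InterpolatesAt n (Lag n f) f ∧
    |LpNormPer p (fun x => f x - Lag n f x) - 2 / π * ψ n * |ρ₀| * Am p n θ₀| ≤
      4 * ∑' k : ℕ, ψ (n+1+k) := by
  have hex : ∀ k : ℕ, ∃ ρ θ : ℝ, |ρ| ≤ 1 ∧ (∀ x, ∫ t in (0:ℝ)..(2*π),
      cos ((k + 1 : ℝ) * (x - t) - π * βb (k + 1) / 2) * φ t = ρ * cos ((k + 1 : ℝ) * x - θ)) ∧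
      (k + 1 = n → ρ = ρ₀ ∧ θ = θ₀) := by
    intro k
    by_cases hk : k + 1 = n
    · refine ⟨ρ₀, θ₀, hρ₀, ?_, fun _ => ⟨rfl, rfl⟩⟩
      intro x
      subst hk
      have := hρ x
      push_cast at this
      exact this
    · obtain ⟨ρ, θ, h1, h2⟩ := amp h (k + 1 : ℝ) (π * βb (k + 1) / 2)
      exact ⟨ρ, θ, h1, h2, fun h => absurd h hk⟩
  choose ρ θ h1 h2 h3 using hex
  obtain ⟨m, rfl⟩ : ∃ m, n = m + 1 := ⟨n - 1, by omega⟩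
  obtain ⟨e1, e2⟩ := h3 m rfl
  set c : ℕ → ℝ := fun k => Nat.casesOn k (a₀ / 2) (fun k => 1 / π * (ψ (k + 1) * ρ k)) with hc
  set θ' : ℕ → ℝ := fun k => Nat.casesOn k 0 θ with hθ
  have hcs : ∀ k, c (k + 1) = 1 / π * (ψ (k + 1) * ρ k) := fun k => rfl
  have rep := class_rep ψ βb hψ hs f φ a₀ h hf ρ θ h2 c θ' rfl (fun k => rfl) rfl (fun k => rfl)
  have hcle : ∀ k, |c (k + 1)| ≤ 1 / π * ψ (k + 1) := by
    intro k
    rw [hcs, abs_mul, abs_mul, abs_of_pos (hψ (k + 1) (by omega)), abs_of_pos (by positivity)]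
    refine mul_le_mul_of_nonneg_left ?_ (by positivity)
    exact mul_le_of_le_one_right (hψ (k + 1) (by omega)).le (h1 k)
  have hsum : Summable (fun k => |c k|) := by
    rw [← summable_nat_add_iff 1]
    exact Summable.of_nonneg_of_le (fun k => abs_nonneg _) hcle (hs.mul_left _)
  refine ⟨ser_interp (m + 1) f c θ' hn rep, ?_⟩
  have key := ser_err (m + 1) f c θ' p hp hn rep hsum
  have ec : 2 * |c (m + 1)| * Am p (m + 1) (θ' (m + 1)) = 2 / π * ψ (m + 1) * |ρ₀| * Am p (m + 1) θ₀ := by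
    rw [hcs, abs_mul, abs_mul, abs_of_pos (hψ (m + 1) (by omega)),
      abs_of_pos (show 0 < 1 / π by positivity), ← e1, ← e2]
    ring
  rw [ec] at key
  refine key.trans ?_
  have hs2 : Summable (fun k => ψ (m + 1 + 1 + k)) := by
    have := hs.comp_injective (add_left_injective (m + 1))
    refine this.congr fun k => ?_
    simp only [Function.comp]
    congr 1; omega
  have : ∑' k, |c (k + (m + 1 + 1))| ≤ ∑' k, 1 / π * ψ (m + 1 + 1 + k) := by
    refine Summable.tsum_le_tsum ?_ (hsum.comp_injective (add_left_injective (m + 1 + 1))) (hs2.mul_left _)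
    intro k
    have := hcle (k + (m + 1))
    rw [show m + 1 + 1 + k = k + (m + 1) + 1 by ring]
    exact this
  rw [tsum_mul_left] at this
  calc 2 * π * (2 * ∑' k, |c (k + (m + 1 + 1))|)
      ≤ 2 * π * (2 * (1 / π * ∑' k, ψ (m + 1 + 1 + k))) := by gcongr
    _ = 4 * ∑' k : ℕ, ψ (m + 1 + 1 + k) := four_aux _

/-- The near-extremal `φ`. -/
noncomputable def phiE (n : ℕ) (t : ℝ) : ℝ :=
  (∫ t in (0:ℝ)..(2*π), cos t ^ (2 * n))⁻¹ * cos (n * t) ^ (2 * n + 1)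

lemma int_scale (n : ℕ) (hn : 1 ≤ n) (g : ℝ → ℝ) (hg : Continuous g) (hP : Function.Periodic g (2 * π)) :
    ∫ t in (0:ℝ)..(2*π), g (n * t) = ∫ t in (0:ℝ)..(2*π), g t := by
  have hn' : (0:ℝ) < n := by exact_mod_cast hn
  have h3 := hP.intervalIntegral_add_zsmul_eq n 0 (fun _ _ => hg.intervalIntegrable _ _)
  rw [intervalIntegral.integral_comp_mul_left g hn'.ne']
  simp only [zero_add, zsmul_eq_mul] at h3
  push_cast at h3
  rw [mul_zero, h3, smul_eq_mul]
  field_simp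

lemma W_pos (n : ℕ) : 0 < ∫ t in (0:ℝ)..(2*π), cos t ^ (2 * n) := by
  induction n with
  | zero => simp [pi_pos]
  | succ m ih =>
    rw [show 2 * (m + 1) = 2 * m + 2 by ring, integral_cos_pow]
    simp only [sin_two_pi, sin_zero, mul_zero, sub_zero, zero_div, zero_add]
    positivity

lemma phiE_adm (n : ℕ) (hn : 1 ≤ n) : AdmPhi (phiE n) := by
  have hW := W_pos n
  have hcont : Continuous (phiE n) := by unfold phiE; fun_prop
  refine ⟨?_, ?_, ?_, ?_⟩
  · intro t
    unfold phiE
    rw [mul_add, cos_add_nat_mul_two_pi]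
  · exact (hcont.continuousOn.integrableOn_compact isCompact_Icc).mono_set Ioc_subset_Icc_self
  · unfold phiE
    rw [intervalIntegral.integral_const_mul,
      int_scale n hn (fun t => cos t ^ (2 * n + 1)) (by fun_prop) (by intro t; simp)]
    have := integral_sin_pow_mul_cos_pow_odd (a := 0) (b := 2 * π) 0 n
    simp only [pow_zero, one_mul, sin_two_pi, sin_zero, intervalIntegral.integral_same] at this
    rw [this, mul_zero]
  · have h1 : ∀ t, |phiE n t| ≤ (∫ t in (0:ℝ)..(2*π), cos t ^ (2 * n))⁻¹ * cos (n * t) ^ (2 * n) := by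
      intro t
      unfold phiE
      rw [abs_mul, abs_of_pos (inv_pos.mpr hW), pow_succ, abs_mul, abs_of_nonneg
        (Even.pow_nonneg (even_two_mul n) _)]
      refine mul_le_mul_of_nonneg_left ?_ (inv_pos.mpr hW).le
      exact mul_le_of_le_one_right (Even.pow_nonneg (even_two_mul n) _) (abs_cos_le_one _)
    calc _ ≤ ∫ t in (0:ℝ)..(2*π), (∫ t in (0:ℝ)..(2*π), cos t ^ (2 * n))⁻¹ * cos (n * t) ^ (2 * n) := by
          apply intervalIntegral.integral_mono_on (by positivity)
          · exact hcont.abs.intervalIntegrable _ _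
          · apply Continuous.intervalIntegrable; fun_prop
          · intro t _; exact h1 t
      _ = 1 := by
          rw [intervalIntegral.integral_const_mul,
            int_scale n hn (fun t => cos t ^ (2 * n)) (by fun_prop) (by intro t; simp)]
          exact inv_mul_cancel₀ hW.ne'

lemma phiE_amp (n : ℕ) (hn : 1 ≤ n) (γ x : ℝ) :
    ∫ t in (0:ℝ)..(2*π), cos ((n:ℝ) * (x - t) - γ) * phiE n t =
      ((2 * (n:ℝ) + 1) / (2 * n + 2)) * cos (n * x - γ) := by
  have hW := W_pos n
  have h := adm_expand (phiE_adm n hn) n (n * x - γ)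
  have e1 : ∫ t in (0:ℝ)..(2*π), cos (n * t) * phiE n t = (2 * (n:ℝ) + 1) / (2 * n + 2) := by
    have : ∀ t, cos (n * t) * phiE n t =
        (∫ t in (0:ℝ)..(2*π), cos t ^ (2 * n))⁻¹ * cos (n * t) ^ (2 * n + 2) := by
      intro t; unfold phiE; ring
    simp_rw [this]
    rw [intervalIntegral.integral_const_mul,
      int_scale n hn (fun t => cos t ^ (2 * n + 2)) (by fun_prop) (by intro t; simp), integral_cos_pow]
    simp only [sin_two_pi, sin_zero, mul_zero, sub_zero, zero_div, zero_add]
    push_cast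
    field_simp
  have e2 : ∫ t in (0:ℝ)..(2*π), sin (n * t) * phiE n t = 0 := by
    have : ∀ t, sin (n * t) * phiE n t =
        (∫ t in (0:ℝ)..(2*π), cos t ^ (2 * n))⁻¹ * (sin (n * t) ^ 1 * cos (n * t) ^ (2 * n + 1)) := by
      intro t; unfold phiE; ring
    simp_rw [this]
    rw [intervalIntegral.integral_const_mul,
      int_scale n hn (fun t => sin t ^ 1 * cos t ^ (2 * n + 1)) (by fun_prop) (by intro t; simp),
      integral_sin_pow_mul_cos_pow_odd]
    simp
  rw [e1, e2, mul_zero, add_zero] at h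
  rw [mul_comm _ (cos (n * x - γ)), ← h]
  congr 1; ext t; congr 2; ring

/-- **Theorem 1 (estimate (8)).** There is an absolute constant `C > 0` such that for all
`1 ≤ p ≤ ∞`, all `β̄`, all positive `ψ` with `Σψ(k) < ∞` and all `n ∈ ℕ`,
`|Ẽ_n(C^ψ_{β̄,1})_{L_p} − (2^{1−1/p}/π^{1+1/p})‖cos‖_p² ψ(n)| ≤ C(ψ(n)/n + Σ_{ν>n} ψ(ν))`. -/
theorem statement0 :
    ∃ C : ℝ, 0 < C ∧ ∀ (p : ℝ≥0∞), 1 ≤ p → ∀ (βb ψ : ℕ → ℝ),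
      (∀ k : ℕ, 1 ≤ k → 0 < ψ k) → Summable (fun k : ℕ => ψ (k+1)) →
      ∀ n : ℕ, 1 ≤ n →
        |interpErr p n (ClassC ψ βb) -
            2 ^ ((1:ℝ) - 1/p.toReal) / π ^ ((1:ℝ) + 1/p.toReal) * (cosLp p) ^ 2 * ψ n| ≤
          C * (ψ n / n + ∑' k : ℕ, ψ (n+1+k)) := by
  refine ⟨2 / π * (2 * π + 4 * π ^ 2) + 4, by positivity, ?_⟩
  intro p hp βb ψ hψ hs n hn
  rw [main_const]
  have hn' : (1:ℝ) ≤ n := by exact_mod_cast hn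
  have hψn := hψ n hn
  set S := ∑' k : ℕ, ψ (n+1+k) with hS
  have hS0 : 0 ≤ S := tsum_nonneg fun k => (hψ _ (by omega)).le
  set K := 2 * π ^ 2 / n with hK
  have hK0 : 0 ≤ K := by positivity
  have hT0 := Tm_nonneg p
  set a := 2 / π * ψ n with ha
  have ha0 : 0 < a := by positivity
  have hTA := Tm_all p hp n hn
  have hAb : ∀ θ, Am p n θ ≤ 2 * π := by
    intro θ
    have := LpPer_bound p hp zero_le_one (abs_Fm_le n θ)
    unfold Am; linarith
  -- upper bound
  have hup : ∀ e ∈ { e : ℝ | ∃ f ∈ ClassC ψ βb, ∃ T : ℝ → ℝ, InterpolatesAt n T f ∧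
      e = LpNormPer p (fun x => f x - T x) }, e ≤ a * (Tm p + K) + 4 * S := by
    rintro e ⟨f, ⟨a₀, φ, hφ, hf⟩, T, hT, rfl⟩
    obtain ⟨ρ, θ, hρ1, hρ⟩ := amp hφ n (π * βb n / 2)
    have h1 := (class_err p hp ψ βb hψ hs n hn f φ a₀ hφ hf ρ θ hρ1 hρ).2
    rw [ser_unique n f hn T hT]
    have h2 := (abs_le.mp h1).2
    have h3 := (abs_le.mp (hTA θ)).2
    have hA0 : 0 ≤ Am p n θ := LpPer_nonneg _ _
    have h4 : a * |ρ| * Am p n θ ≤ a * (Tm p + K) := by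
      calc a * |ρ| * Am p n θ ≤ a * 1 * Am p n θ := by gcongr
        _ = a * Am p n θ := by ring
        _ ≤ a * (Tm p + K) := by gcongr; linarith
    linarith
  -- lower bound
  set ρ₀ : ℝ := (2 * (n:ℝ) + 1) / (2 * n + 2) with hρ₀
  have hρpos : 0 ≤ ρ₀ := by positivity
  have hρle : ρ₀ ≤ 1 := by rw [hρ₀, div_le_one (by positivity)]; linarith
  have hρge : 1 - 1 / n ≤ ρ₀ := by
    have : ρ₀ = 1 - 1 / (2 * n + 2) := by rw [hρ₀]; field_simp; ring
    rw [this]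
    have : (1:ℝ) / (2 * n + 2) ≤ 1 / n := by gcongr; linarith
    linarith
  have hlow : ∃ e ∈ { e : ℝ | ∃ f ∈ ClassC ψ βb, ∃ T : ℝ → ℝ, InterpolatesAt n T f ∧
      e = LpNormPer p (fun x => f x - T x) }, a * Tm p - a * (K + 2 * π / n) - 4 * S ≤ e := by
    obtain ⟨h1, h2⟩ := class_err p hp ψ βb hψ hs n hn
      (fun x => 0 / 2 + (1/π) * ∫ t in (0:ℝ)..(2*π), ker1 ψ βb (x - t) * phiE n t) (phiE n) 0
      (phiE_adm n hn) (fun x => rfl) ρ₀ (π * βb n / 2) (by rw [abs_of_nonneg hρpos]; exact hρle)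
      (phiE_amp n hn _)
    refine ⟨_, ⟨_, ⟨0, phiE n, phiE_adm n hn, fun x => rfl⟩, _, h1, rfl⟩, ?_⟩
    have h3 := (abs_le.mp h2).1
    rw [abs_of_nonneg hρpos] at h3
    have hA := hTA (π * βb n / 2)
    have hB := hAb (π * βb n / 2)
    have hA0 : 0 ≤ Am p n (π * βb n / 2) := LpPer_nonneg _ _
    set A := Am p n (π * βb n / 2)
    have h4 := (abs_le.mp hA).1
    have h5 : Tm p - K - 2 * π / n ≤ ρ₀ * A := by
      have h6 : (1 - 1 / n) * A ≤ ρ₀ * A := by gcongr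
      have h7 : 1 / n * A ≤ 1 / n * (2 * π) := by gcongr
      have h8 : 1 / n * (2 * π) = 2 * π / n := by ring
      linarith
    have h9 := mul_le_mul_of_nonneg_left h5 ha0.le
    have h10 : a * ρ₀ * A = a * (ρ₀ * A) := by ring
    linarith
  obtain ⟨e, he, hel⟩ := hlow
  have hE1 : interpErr p n (ClassC ψ βb) ≤ a * (Tm p + K) + 4 * S := csSup_le ⟨e, he⟩ hup
  have hE2 : e ≤ interpErr p n (ClassC ψ βb) := le_csSup ⟨_, hup⟩ he
  have hmain : 2 / π * Tm p * ψ n = a * Tm p := by rw [ha]; ring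
  have hbound : a * (K + 2 * π / n) + 4 * S ≤
      (2 / π * (2 * π + 4 * π ^ 2) + 4) * (ψ n / n + S) := by
    have e1 : (2 / π * (2 * π + 4 * π ^ 2) + 4) * (ψ n / n + S) =
      a * (K + 2 * π / n) + 4 * S + (a * K + 4 * (ψ n / n) + (2 / π * (2 * π + 4 * π ^ 2)) * S) := by
      rw [ha, hK]; field_simp; ring
    rw [e1]
    have : 0 ≤ a * K + 4 * (ψ n / n) + (2 / π * (2 * π + 4 * π ^ 2)) * S := by positivity
    linarith
  have hpos : 0 ≤ a * (2 * π / n) := by positivity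
  rw [hmain, abs_le]
  constructor
  · linarith
  · have : a * (K + 2 * π / n) = a * K + a * (2 * π / n) := by ring
    have : a * (Tm p + K) = a * Tm p + a * K := by ring
    linarith
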